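/- Let 𝒯 be a staged tree and let 𝒮 be a subtree of 𝒯 with the same root; let v₁,…,v_m be the vertices of 𝒯 that are leaves of 𝒮. Suppose (1) the staged tree 𝒮 is balanced, (2) no internal vertex of 𝒮 is in the same stage as any vertex of the induced subtrees 𝒯(v₁),…,𝒯(v_m), and (3) every stage of vertices occurring in 𝒯(v₁),…,𝒯(v_m) satisfies the subtree-inclusion property. Then 𝒯 has toric structure: there are linearly independent linear forms ℓ₁,…,ℓ_n in ℝ[p₁,…,p_n] in which ker φ_𝒯 is generated by binomials. -/

import Mathlib

noncomputable section
open scoped Classical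
open MvPolynomial

/-- A staged tree: a finite rooted tree with edges directed away from the root,
each non-root vertex `c` carrying the label `label c` of the edge from `parent c` to `c`;
labels of outgoing edges of a vertex are pairwise distinct, and the outgoing label sets
of two vertices are either equal (same stage) or disjoint. -/
structure StagedTree (Θ : Type) [DecidableEq Θ] : Type 1 where
  V : Type
  fintypeV : Fintype V
  decEqV : DecidableEq V
  root : V
  parent : V → V
  label : V → Θ
  parent_root : parent root = root
  reaches_root : ∀ v : V, ∃ n : ℕ, parent^[n] v = root
  label_inj : ∀ u v : V, u ≠ root → v ≠ root → parent u = parent v → label u = label v → u = v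
  stage_disjoint : ∀ u v : V,
    (∀ θ : Θ, (∃ c, c ≠ root ∧ parent c = u ∧ label c = θ) ↔
        (∃ c, c ≠ root ∧ parent c = v ∧ label c = θ)) ∨
    (∀ θ : Θ, ¬((∃ c, c ≠ root ∧ parent c = u ∧ label c = θ) ∧
        (∃ c, c ≠ root ∧ parent c = v ∧ label c = θ)))

namespace StagedTree

attribute [instance] StagedTree.fintypeV StagedTree.decEqV

variable {Θ : Type} [DecidableEq Θ] (T : StagedTree Θ)

/-- `c` is a child of `v`. -/
def IsChild (v c : T.V) : Prop := c ≠ T.root ∧ T.parent c = v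

/-- `v` is a leaf (no children). -/
def IsLeaf (v : T.V) : Prop := ∀ c, ¬ T.IsChild v c

/-- `w` lies in the subtree rooted at `v` (i.e. `v` is an ancestor of `w` or `w` itself). -/
def Desc (v w : T.V) : Prop := ∃ n : ℕ, T.parent^[n] w = v

/-- Distance of `v` from the root. -/
def depthOf (v : T.V) : ℕ := Nat.find (T.reaches_root v)

/-- The depth `d` of the tree: maximal number of edges on a root-to-leaf path. -/
def depth : ℕ := Finset.univ.sup T.depthOf

/-- The type of leaves of `T`. -/
def Leaf : Type := {v : T.V // T.IsLeaf v}

instance : Fintype T.Leaf := Subtype.fintype _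

/-- Product of the labels along the root-to-`v` path, in `ℝ[Θ]`. -/
def pathProd (v : T.V) : MvPolynomial Θ ℝ :=
  ∏ i ∈ Finset.range (T.depthOf v), X (T.label (T.parent^[i] v))

/-- Homogenised root-to-`v` path monomial `z^(d - d(λ)) ∏ θ(e)` in `ℝ[Θ, z]`,
where the variable `none` plays the role of `z`. -/
def hpm (v : T.V) : MvPolynomial (Option Θ) ℝ :=
  (X none) ^ (T.depth - T.depthOf v) *
    ∏ i ∈ Finset.range (T.depthOf v), X (some (T.label (T.parent^[i] v)))

/-- The ideal `⟨θ - z⟩` of homogenised local sum-to-one conditions. -/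
def sumIdeal : Ideal (MvPolynomial (Option Θ) ℝ) :=
  Ideal.span {f | ∃ v : T.V, ¬ T.IsLeaf v ∧
    f = (∑ c ∈ Finset.univ.filter (fun c => T.IsChild v c), X (some (T.label c))) - X none}

/-- The homogenised parametrisation `φ_T : ℝ[p] → ℝ[Θ, z]/⟨θ - z⟩`. -/
def phi : MvPolynomial T.Leaf ℝ →ₐ[ℝ] MvPolynomial (Option Θ) ℝ ⧸ T.sumIdeal :=
  aeval (fun l : T.Leaf => Ideal.Quotient.mk T.sumIdeal (T.hpm l.1))

/-- The ideal `⟨θ - 1⟩` of local sum-to-one conditions. -/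
def oneIdeal : Ideal (MvPolynomial Θ ℝ) :=
  Ideal.span {f | ∃ v : T.V, ¬ T.IsLeaf v ∧
    f = (∑ c ∈ Finset.univ.filter (fun c => T.IsChild v c), X (T.label c)) - 1}

/-- The (non-homogenised) parametrisation `φ_T : ℝ[p] → ℝ[Θ]/⟨θ - 1⟩`. -/
def phi1 : MvPolynomial T.Leaf ℝ →ₐ[ℝ] MvPolynomial Θ ℝ ⧸ T.oneIdeal :=
  aeval (fun l : T.Leaf => Ideal.Quotient.mk T.oneIdeal (T.pathProd l.1))

/-- The subtree polynomial `t(v)`: sum over all `v`-to-leaf paths of the products of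
edge labels along the path. -/
def tpoly (v : T.V) : MvPolynomial Θ ℝ :=
  ∑ l ∈ Finset.univ.filter (fun w => T.IsLeaf w ∧ T.Desc v w),
    ∏ i ∈ Finset.range (T.depthOf l - T.depthOf v), X (T.label (T.parent^[i] l))

/-- Two non-leaf vertices are in the same stage when their outgoing label sets coincide. -/
def SameStage (u v : T.V) : Prop :=
  ¬ T.IsLeaf u ∧ ¬ T.IsLeaf v ∧
    ∀ θ : Θ, (∃ c, T.IsChild u c ∧ T.label c = θ) ↔ (∃ c, T.IsChild v c ∧ T.label c = θ)

/-- `T` is balanced: `t(u_i)·t(v_j) = t(u_j)·t(v_i)` for all `u ∼ v` and all pairs of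
children matched via the common labels. -/
def Balanced : Prop :=
  ∀ u v ui uj vi vj : T.V, T.SameStage u v →
    T.IsChild u ui → T.IsChild u uj → T.IsChild v vi → T.IsChild v vj →
    T.label ui = T.label vi → T.label uj = T.label vj →
    T.tpoly ui * T.tpoly vj = T.tpoly uj * T.tpoly vi

/-- `p_{[v]}`: sum of the variables `p_r` over root-to-leaf paths through `v`. -/
def pSum (v : T.V) : MvPolynomial T.Leaf ℝ :=
  ∑ l ∈ Finset.univ.filter (fun l : T.Leaf => T.Desc v l.1), X l

/-- `T` has toric structure: there are linearly independent linear forms in which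
`ker φ_T` is generated by binomials. -/
def Toric : Prop :=
  ∃ L : T.Leaf → MvPolynomial T.Leaf ℝ,
    (∀ i, (L i).IsHomogeneous 1) ∧ LinearIndependent ℝ L ∧
    ∃ B : Set (MvPolynomial T.Leaf ℝ),
      (∀ f ∈ B, ∃ a b : T.Leaf → ℕ, f = (∏ i, L i ^ a i) - (∏ i, L i ^ b i)) ∧
      RingHom.ker T.phi.toRingHom = Ideal.span B

end StagedTree

namespace StagedTree

variable {Θ : Type} [DecidableEq Θ] (T : StagedTree Θ)

open MvPolynomial

/-- The induced subtree of `T` rooted at `v₁` is contained, as an edge-labelled coloured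
tree, in the induced subtree rooted at `vi`, via an embedding sending `v₁` to `vi` which
preserves parents, edge labels and stages. -/
def SIPat (v1 vi : T.V) : Prop :=
  ∃ f : T.V → T.V, f v1 = vi ∧ Set.InjOn f {w | T.Desc v1 w} ∧
    (∀ w, T.Desc v1 w → w ≠ v1 →
      f w ≠ T.root ∧ T.parent (f w) = f (T.parent w) ∧ T.label (f w) = T.label w) ∧
    (∀ w, T.Desc v1 w → ¬ T.IsLeaf w → T.SameStage w (f w))

/-- `T` is an SIP-tree (drawn so that `i_c = 1`, the first label being the least one):
for every vertex of every stage, the subtree rooted at the first child is contained in the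
subtree rooted at each child. -/
def IsSIP [LinearOrder Θ] : Prop :=
  ∀ v c1 c : T.V, T.IsChild v c1 → T.IsChild v c →
    (∀ c', T.IsChild v c' → T.label c1 ≤ T.label c') → T.SIPat c1 c

/-- `x` is reached by a first-edge: the edge into `x` carries the first (least) label of
the stage of its parent. -/
def FirstEdge [LinearOrder Θ] (x : T.V) : Prop :=
  x ≠ T.root ∧ ∀ c, T.IsChild (T.parent x) c → T.label x ≤ T.label c

end StagedTree

namespace StagedTree

variable {Θ : Type} [DecidableEq Θ] (T : StagedTree Θ)

open MvPolynomial

/-- `v` is a leaf of the subtree `𝒮` determined by the set `S` of its vertices. -/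
def SLeaf (S : Set T.V) (v : T.V) : Prop :=
  v ∈ S ∧ ∀ c, T.IsChild v c → c ∉ S

/-- `v` is an internal (non-leaf) vertex of the subtree `𝒮`. -/
def SInternal (S : Set T.V) (v : T.V) : Prop :=
  v ∈ S ∧ ∃ c, T.IsChild v c ∧ c ∈ S

/-- `w` belongs to one of the induced subtrees `𝒯(v₁),…,𝒯(v_m)` rooted at the leaves of
`𝒮`. -/
def InBottom (S : Set T.V) (w : T.V) : Prop :=
  ∃ v, T.SLeaf S v ∧ T.Desc v w

/-- The subtree polynomial of `v` computed inside the subtree `𝒮`: the sum over all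
`v`-to-(leaf of `𝒮`) paths of the products of the edge labels along the path. -/
def tpolyIn (S : Set T.V) (v : T.V) : MvPolynomial Θ ℝ :=
  ∑ l ∈ Finset.univ.filter (fun w => T.SLeaf S w ∧ T.Desc v w),
    ∏ i ∈ Finset.range (T.depthOf l - T.depthOf v), X (T.label (T.parent^[i] l))

/-- The subtree `𝒮` is balanced, as a staged tree in its own right. -/
def BalancedIn (S : Set T.V) : Prop :=
  ∀ u v ui uj vi vj : T.V, T.SInternal S u → T.SInternal S v → T.SameStage u v →
    T.IsChild u ui → T.IsChild u uj → T.IsChild v vi → T.IsChild v vj →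
    T.label ui = T.label vi → T.label uj = T.label vj →
    T.tpolyIn S ui * T.tpolyIn S vj = T.tpolyIn S uj * T.tpolyIn S vi

theorem depthOf_root : T.depthOf T.root = 0 := by
  simp [depthOf]

theorem depthOf_parent {v : T.V} (hv : v ≠ T.root) :
    T.depthOf v = T.depthOf (T.parent v) + 1 := by
  unfold depthOf
  exact Nat.find_comp_succ _ (T.reaches_root (T.parent v)) hv

theorem depthOf_le_depth (v : T.V) : T.depthOf v ≤ T.depth :=
  Finset.le_sup (f := T.depthOf) (Finset.mem_univ v)

theorem Desc.refl (v : T.V) : T.Desc v v := ⟨0, rfl⟩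

theorem desc_root (v : T.V) : T.Desc T.root v := T.reaches_root v

variable {T}

theorem IsChild.depthOf {v c : T.V} (h : T.IsChild v c) : T.depthOf c = T.depthOf v + 1 := by
  rw [T.depthOf_parent h.1, h.2]

theorem Desc.of_parent {w v : T.V} (h : T.Desc w (T.parent v)) : T.Desc w v := by
  obtain ⟨n, hn⟩ := h
  exact ⟨n + 1, hn⟩

theorem Desc.trans {a b c : T.V} (h : T.Desc a b) (h' : T.Desc b c) : T.Desc a c := by
  obtain ⟨n, rfl⟩ := h
  obtain ⟨m, rfl⟩ := h'
  exact ⟨n + m, Function.iterate_add_apply _ _ _ _⟩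

theorem IsChild.desc {v c : T.V} (h : T.IsChild v c) : T.Desc v c := ⟨1, h.2⟩

theorem Desc.parent_of_ne {w v : T.V} (h : T.Desc w v) (hne : v ≠ w) :
    v ≠ T.root ∧ T.Desc w (T.parent v) := by
  obtain ⟨n, hn⟩ := h
  cases n with
  | zero => exact absurd hn hne
  | succ n =>
    refine ⟨?_, n, hn⟩
    rintro rfl
    exact hne (((Function.iterate_fixed T.parent_root _).symm.trans hn))

/-- Induction on the descendants of a vertex, going away from it. -/
@[elab_as_elim]
theorem Desc.induction {w : T.V} {P : T.V → Prop} (base : P w)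
    (step : ∀ u, u ≠ T.root → u ≠ w → T.Desc w (T.parent u) → P (T.parent u) → P u)
    {v : T.V} (h : T.Desc w v) : P v := by
  obtain ⟨n, hn⟩ := h
  induction n generalizing v with
  | zero => exact (show v = w from hn) ▸ base
  | succ n ih =>
    by_cases hvw : v = w
    · exact hvw ▸ base
    · obtain ⟨h0, h1⟩ := Desc.parent_of_ne ⟨n + 1, hn⟩ hvw
      exact step v h0 hvw h1 (ih hn)

theorem Desc.depthOf_le {w v : T.V} (h : T.Desc w v) : T.depthOf w ≤ T.depthOf v := by
  refine h.induction le_rfl fun u hu _ _ ih => ?_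
  rw [T.depthOf_parent hu]
  omega

theorem Desc.iterate_eq {w v : T.V} (h : T.Desc w v) :
    T.parent^[T.depthOf v - T.depthOf w] v = w := by
  refine h.induction (by simp) fun u hu _ hd ih => ?_
  rw [T.depthOf_parent hu, Nat.sub_add_comm hd.depthOf_le]
  exact ih

theorem Desc.exists_child {w v : T.V} (h : T.Desc w v) (hne : v ≠ w) :
    ∃ c, T.IsChild w c ∧ T.Desc c v := by
  refine h.induction (P := fun v => v ≠ w → ∃ c, T.IsChild w c ∧ T.Desc c v)
    (fun h => absurd rfl h) (fun u hu _ _ ih _ => ?_) hne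
  by_cases hp : T.parent u = w
  · exact ⟨u, ⟨hu, hp⟩, Desc.refl T u⟩
  · obtain ⟨c, hc, hcd⟩ := ih hp
    exact ⟨c, hc, hcd.of_parent⟩

theorem IsChild.eq_of_desc {w c c' v : T.V} (hc : T.IsChild w c) (hc' : T.IsChild w c')
    (h : T.Desc c v) (h' : T.Desc c' v) : c = c' := by
  rw [← h.iterate_eq, ← h'.iterate_eq, hc.depthOf, hc'.depthOf]

theorem IsChild.not_desc {w c : T.V} (hc : T.IsChild w c) : ¬ T.Desc c w := fun h => by
  have := h.depthOf_le
  rw [hc.depthOf] at this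
  omega

theorem Desc.eq_of_isLeaf {w v : T.V} (h : T.Desc w v) (hw : T.IsLeaf w) : v = w := by
  by_contra hne
  obtain ⟨c, hc, -⟩ := h.exists_child hne
  exact hw c hc

theorem IsChild.label_injective {w c c' : T.V} (hc : T.IsChild w c) (hc' : T.IsChild w c')
    (h : T.label c = T.label c') : c = c' :=
  T.label_inj c c' hc.1 hc'.1 (hc.2.trans hc'.2.symm) h

/-- Two ancestors of a vertex are comparable. -/
theorem Desc.total {a b v : T.V} (ha : T.Desc a v) (hb : T.Desc b v) :
    T.Desc a b ∨ T.Desc b a := by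
  obtain ⟨n, rfl⟩ := ha
  obtain ⟨m, rfl⟩ := hb
  rcases le_total n m with h | h
  · exact .inr ⟨m - n, by rw [← Function.iterate_add_apply, Nat.sub_add_cancel h]⟩
  · exact .inl ⟨n - m, by rw [← Function.iterate_add_apply, Nat.sub_add_cancel h]⟩

/-- A sum over the descendants of `w` splits along the children of `w`. -/
theorem sum_desc_eq_sum_children {M : Type*} [AddCommMonoid M] (p : T.V → Prop) (F : T.V → M)
    {w : T.V} (hw : ¬ p w) :
    ∑ l ∈ Finset.univ.filter (fun l => p l ∧ T.Desc w l), F l =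
      ∑ c ∈ Finset.univ.filter (fun c => T.IsChild w c),
        ∑ l ∈ Finset.univ.filter (fun l => p l ∧ T.Desc c l), F l := by
  rw [← Finset.sum_biUnion]
  · refine Finset.sum_congr ?_ fun _ _ => rfl
    ext l
    simp only [Finset.mem_filter, Finset.mem_univ, true_and, Finset.mem_biUnion]
    constructor
    · rintro ⟨hl, hd⟩
      obtain ⟨c, hc, hcl⟩ := hd.exists_child (fun h => hw (h ▸ hl))
      exact ⟨c, hc, hl, hcl⟩
    · rintro ⟨c, hc, hl, hd⟩
      exact ⟨hl, hc.desc.trans hd⟩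
  · intro c hc c' hc' hne
    refine Finset.disjoint_left.2 fun l hl hl' => hne ?_
    simp only [Finset.coe_filter, Finset.mem_univ, true_and, Set.mem_ofPred_eq,
      Finset.mem_filter] at hc hc' hl hl'
    exact hc.eq_of_desc hc' hl.2 hl'.2

section Seg

variable {M : Type*} [CommMonoid M] (g : T.V → M)

/-- The product of the weights `g` of the edges on the path from `w` to `v`, the weight of an
edge being indexed by its lower endpoint. -/
def seg (w v : T.V) : M :=
  ∏ i ∈ Finset.range (T.depthOf v - T.depthOf w), g (T.parent^[i] v)

theorem seg_self (w : T.V) : seg g w w = 1 := by simp [seg]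

theorem seg_root (v : T.V) :
    seg g T.root v = ∏ i ∈ Finset.range (T.depthOf v), g (T.parent^[i] v) := by
  simp [seg, depthOf_root]

theorem seg_step {w v : T.V} (hv : v ≠ T.root) (h : T.Desc w (T.parent v)) :
    seg g w v = g v * seg g w (T.parent v) := by
  rw [seg, T.depthOf_parent hv, Nat.sub_add_comm h.depthOf_le, Finset.prod_range_succ', mul_comm]
  rfl

theorem seg_mul_seg {a b v : T.V} (hab : T.Desc a b) (h : T.Desc b v) :
    seg g a v = seg g a b * seg g b v := by
  refine h.induction (by simp [seg_self]) fun u hu _ hd ih => ?_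
  rw [seg_step g hu (hab.trans hd), seg_step g hu hd, ih, mul_left_comm]

theorem seg_isChild {w c : T.V} (hc : T.IsChild w c) : seg g w c = g c := by
  rw [seg_step g hc.1 (hc.2 ▸ Desc.refl T _), hc.2, seg_self, mul_one]

theorem seg_child {w c v : T.V} (hc : T.IsChild w c) (h : T.Desc c v) :
    seg g w v = g c * seg g c v := by
  rw [seg_mul_seg g hc.desc h, seg_isChild g hc]

theorem seg_congr {g' : T.V → M} {w v : T.V} (h : T.Desc w v)
    (hg : ∀ u, T.Desc w u → T.Desc u v → u ≠ w → g u = g' u) : seg g w v = seg g' w v := by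
  refine h.induction (P := fun v => (∀ u, T.Desc w u → T.Desc u v → u ≠ w → g u = g' u) →
    seg g w v = seg g' w v) (fun _ => by simp [seg_self]) (fun u hu huw hd ih hg => ?_) hg
  rw [seg_step g hu hd, seg_step g' hu hd, hg u hd.of_parent (Desc.refl T u) huw,
    ih fun x hx hx' => hg x hx (Desc.of_parent hx')]

end Seg

/-- The combinatorial part of a subtree inclusion. -/
structure IsSubtreeEmbedding (v₁ v₂ : T.V) (f : T.V → T.V) : Prop where
  map_root : f v₁ = v₂
  map_step : ∀ w, T.Desc v₁ w → w ≠ v₁ →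
    f w ≠ T.root ∧ T.parent (f w) = f (T.parent w) ∧ T.label (f w) = T.label w
  sameStage : ∀ w, T.Desc v₁ w → ¬ T.IsLeaf w → T.SameStage w (f w)

namespace IsSubtreeEmbedding

variable {v₁ v₂ : T.V} {f : T.V → T.V}

theorem desc (hf : IsSubtreeEmbedding v₁ v₂ f) {w : T.V} (h : T.Desc v₁ w) : T.Desc v₂ (f w) := by
  refine h.induction (hf.map_root ▸ Desc.refl T _) fun u hu hne hd ih => ?_
  obtain ⟨-, h2, -⟩ := hf.map_step u hd.of_parent hne
  exact Desc.of_parent (h2 ▸ ih)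

theorem depthOf_add (hf : IsSubtreeEmbedding v₁ v₂ f) {w : T.V} (h : T.Desc v₁ w) :
    T.depthOf (f w) + T.depthOf v₁ = T.depthOf w + T.depthOf v₂ := by
  refine h.induction (by rw [hf.map_root, add_comm]) fun u hu hne hd ih => ?_
  obtain ⟨h1, h2, -⟩ := hf.map_step u hd.of_parent hne
  rw [T.depthOf_parent h1, h2, T.depthOf_parent hu]
  omega

theorem seg_eq (hf : IsSubtreeEmbedding v₁ v₂ f) {M : Type*} [CommMonoid M] (g : T.V → M)
    (hg : ∀ w, T.Desc v₁ w → w ≠ v₁ → g (f w) = g w) {w : T.V} (h : T.Desc v₁ w) :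
    seg g v₂ (f w) = seg g v₁ w := by
  refine h.induction (by rw [hf.map_root, seg_self, seg_self]) fun u hu hne hd ih => ?_
  obtain ⟨h1, h2, -⟩ := hf.map_step u hd.of_parent hne
  rw [seg_step g h1 (h2 ▸ hf.desc hd), seg_step g hu hd, h2, ih, hg u hd.of_parent hne]

end IsSubtreeEmbedding

section Bottom

variable {S : Set T.V}

theorem SLeaf.eq_of_desc (hpar : ∀ w ∈ S, T.parent w ∈ S) {v u : T.V} (hv : T.SLeaf S v)
    (h : T.Desc v u) (hu : u ∈ S) : u = v := by
  refine h.induction (P := fun u => u ∈ S → u = v) (fun _ => rfl) (fun u hu _ _ ih huS => ?_) hu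
  exact absurd huS (hv.2 u ⟨hu, ih (hpar u huS)⟩)

theorem SLeaf.unique (hpar : ∀ w ∈ S, T.parent w ∈ S) {v v' x : T.V} (hv : T.SLeaf S v)
    (hv' : T.SLeaf S v') (h : T.Desc v x) (h' : T.Desc v' x) : v = v' := by
  rcases h.total h' with h | h
  · exact (hv.eq_of_desc hpar h hv'.1).symm
  · exact hv'.eq_of_desc hpar h hv.1

theorem InBottom.of_desc {w v : T.V} (hw : T.InBottom S w) (h : T.Desc w v) :
    T.InBottom S v := by
  obtain ⟨u, hu, huw⟩ := hw
  exact ⟨u, hu, huw.trans h⟩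

theorem InBottom.sLeaf (hpar : ∀ w ∈ S, T.parent w ∈ S) {w : T.V} (hw : T.InBottom S w)
    (hS : w ∈ S) : T.SLeaf S w := by
  obtain ⟨v, hv, hvw⟩ := hw
  exact hv.eq_of_desc hpar hvw hS ▸ hv

theorem InBottom.child_notMem (hpar : ∀ w ∈ S, T.parent w ∈ S) {w c : T.V}
    (hw : T.InBottom S w) (hc : T.IsChild w c) : c ∉ S := by
  intro hcS
  obtain ⟨v, hv, hvw⟩ := hw
  have := hv.eq_of_desc hpar (hvw.trans hc.desc) hcS
  exact hc.not_desc (this ▸ hvw)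

theorem notMem_of_desc (hpar : ∀ w ∈ S, T.parent w ∈ S) {w v : T.V} (hw : w ∉ S)
    (h : T.Desc w v) : v ∉ S := by
  refine h.induction hw fun u _ _ _ ih huS => ih (hpar u huS)

theorem inBottom_of_notMem (hroot : T.root ∈ S)
    (hsib : ∀ v c c', T.IsChild v c → T.IsChild v c' → c ∈ S → c' ∈ S) {w : T.V} (hw : w ∉ S) :
    T.InBottom S (T.parent w) := by
  refine (T.desc_root w).induction (P := fun w => w ∉ S → T.InBottom S (T.parent w))
    (fun h => absurd hroot h) (fun u hu _ _ ih huS => ?_) hw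
  by_cases hp : T.parent u ∈ S
  · exact ⟨T.parent u, ⟨hp, fun c hc hcS => huS (hsib _ c u hc ⟨hu, rfl⟩ hcS)⟩, Desc.refl T _⟩
  · exact (ih hp).of_desc (IsChild.desc ⟨fun h => hp (h ▸ hroot), rfl⟩)

theorem sInternal_or_inBottom (hroot : T.root ∈ S)
    (hsib : ∀ v c c', T.IsChild v c → T.IsChild v c' → c ∈ S → c' ∈ S) (w : T.V) :
    T.SInternal S w ∨ T.InBottom S w := by
  by_cases hw : w ∈ S
  · by_cases h : ∃ c, T.IsChild w c ∧ c ∈ S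
    · exact .inl ⟨hw, h⟩
    · exact .inr ⟨w, ⟨hw, fun c hc hcS => h ⟨c, hc, hcS⟩⟩, Desc.refl T w⟩
  · refine .inr ((inBottom_of_notMem hroot hsib hw).of_desc (IsChild.desc ⟨?_, rfl⟩))
    rintro rfl
    exact hw hroot

theorem exists_sLeaf (hroot : T.root ∈ S)
    (hsib : ∀ v c c', T.IsChild v c → T.IsChild v c' → c ∈ S → c' ∈ S) (x : T.Leaf) :
    T.InBottom S x.1 :=
  (sInternal_or_inBottom hroot hsib x.1).resolve_left fun ⟨_, c, hc, _⟩ => x.2 c hc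

theorem phi_X (x : T.Leaf) :
    T.phi (X x) = Ideal.Quotient.mk T.sumIdeal (T.hpm x.1) := by
  rw [phi, aeval_X]

theorem mk_sum_label {w : T.V} (hw : ¬ T.IsLeaf w) :
    ∑ c ∈ Finset.univ.filter (fun c => T.IsChild w c),
      Ideal.Quotient.mk T.sumIdeal (X (some (T.label c))) =
        Ideal.Quotient.mk T.sumIdeal (X none) := by
  rw [← map_sum, Ideal.Quotient.eq]
  exact Ideal.subset_span ⟨w, hw, rfl⟩

variable (T) in
/-- The span of the variables indexed by the leaves below `w`. -/
def leafSpan (w : T.V) : Submodule ℝ (MvPolynomial T.Leaf ℝ) :=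
  Submodule.span ℝ {f | ∃ x : T.Leaf, T.Desc w x.1 ∧ f = X x}

theorem leafSpan_mono {w v : T.V} (h : T.Desc w v) : T.leafSpan v ≤ T.leafSpan w :=
  Submodule.span_mono fun _ ⟨x, hx, hf⟩ => ⟨x, h.trans hx, hf⟩

theorem leafSpan_le_of_children {w : T.V} (hw : ¬ T.IsLeaf w)
    {U : Submodule ℝ (MvPolynomial T.Leaf ℝ)} (h : ∀ c, T.IsChild w c → T.leafSpan c ≤ U) :
    T.leafSpan w ≤ U := by
  refine Submodule.span_le.2 ?_
  rintro f ⟨x, hx, rfl⟩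
  obtain ⟨c, hc, hcx⟩ := hx.exists_child (fun h => hw (h ▸ x.2))
  exact h c hc (Submodule.subset_span ⟨x, hcx, rfl⟩)

section Order

variable [LinearOrder Θ]

variable (S) in
/-- The variable attached to an edge (indexed by its lower endpoint) after the first edge of
every bottom stage has been replaced by the homogenising variable. -/
def modLabel (v : T.V) : Option Θ :=
  if v ∉ S ∧ ∀ c, T.IsChild (T.parent v) c → T.label v ≤ T.label c then none
  else some (T.label v)

theorem modLabel_of_mem {v : T.V} (hv : v ∈ S) : modLabel S v = some (T.label v) :=
  if_neg fun h => h.1 hv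

theorem IsSubtreeEmbedding.modLabel_eq (hpar : ∀ w ∈ S, T.parent w ∈ S) {v₁ v₂ : T.V}
    {f : T.V → T.V} (hf : IsSubtreeEmbedding v₁ v₂ f) (h₁ : v₁ ∉ S) (h₂ : v₂ ∉ S) {w : T.V}
    (h : T.Desc v₁ w) (hne : w ≠ v₁) : modLabel S (f w) = modLabel S w := by
  obtain ⟨h3, h4, h5⟩ := hf.map_step w h hne
  obtain ⟨h6, h7⟩ := h.parent_of_ne hne
  have hw : w ∉ S := notMem_of_desc hpar h₁ h
  have hfw : f w ∉ S := notMem_of_desc hpar h₂ (hf.desc h)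
  obtain ⟨-, -, hst⟩ := hf.sameStage (T.parent w) h7 fun hl => hl w ⟨h6, rfl⟩
  have key : (∀ c, T.IsChild (T.parent (f w)) c → T.label w ≤ T.label c) ↔
      ∀ c, T.IsChild (T.parent w) c → T.label w ≤ T.label c := by
    rw [h4]
    constructor
    · intro H c hc
      obtain ⟨c', hc', he⟩ := (hst _).1 ⟨c, hc, rfl⟩
      exact he ▸ H c' hc'
    · intro H c hc
      obtain ⟨c', hc', he⟩ := (hst _).2 ⟨c, hc, rfl⟩
      exact he ▸ H c' hc'
  unfold modLabel
  simp only [hw, hfw, not_false_eq_true, true_and, key, h5]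

variable (S) in
/-- The monomial attached to a descendant `v` of `w` after replacing the first edges of the
path from `w` to `v` by the homogenising variable. -/
def bottomMonomial (w v : T.V) : MvPolynomial (Option Θ) ℝ :=
  seg (fun u => X (some (T.label u))) T.root w * seg (fun u => X (modLabel S u)) w v *
    X none ^ (T.depth - T.depthOf v)

theorem bottomMonomial_child {w c : T.V} (hc : T.IsChild w c) (v : T.V) :
    bottomMonomial S c v = X (some (T.label c)) *
      (seg (fun u => X (some (T.label u))) T.root w * seg (fun u => X (modLabel S u)) c v *
        X none ^ (T.depth - T.depthOf v)) := by
  rw [bottomMonomial, seg_mul_seg _ (T.desc_root w) hc.desc, seg_isChild _ hc]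
  ring

theorem bottomMonomial_eq_modLabel_mul {w c v : T.V} (hc : T.IsChild w c) (hv : T.Desc c v) :
    bottomMonomial S w v = X (modLabel S c) *
      (seg (fun u => X (some (T.label u))) T.root w * seg (fun u => X (modLabel S u)) c v *
        X none ^ (T.depth - T.depthOf v)) := by
  rw [bottomMonomial, seg_child _ hc hv]
  ring

theorem bottomMonomial_self {w c : T.V} (hc : T.IsChild w c) :
    bottomMonomial S w w = X none *
      (seg (fun u => X (some (T.label u))) T.root w * seg (fun u => X (modLabel S u)) c c *
        X none ^ (T.depth - T.depthOf c)) := by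
  have h := T.depthOf_le_depth c
  rw [hc.depthOf] at h
  rw [bottomMonomial, seg_self, seg_self, hc.depthOf,
    show T.depth - T.depthOf w = T.depth - (T.depthOf w + 1) + 1 by omega, pow_succ]
  ring

theorem bottomMonomial_eq_hpm (v : T.V) : bottomMonomial S v v = T.hpm v := by
  rw [hpm, bottomMonomial, seg_self, seg_root]
  ring

theorem exists_bottom_forms (hpar : ∀ w ∈ S, T.parent w ∈ S)
    (hsip : ∀ w c1 c, T.InBottom S w → T.IsChild w c1 → T.IsChild w c →
      (∀ c', T.IsChild w c' → T.label c1 ≤ T.label c') → T.SIPat c1 c)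
    (w : T.V) (hw : T.InBottom S w) :
    ∃ l : T.V → MvPolynomial T.Leaf ℝ,
      (∀ v, T.Desc w v → l v ∈ T.leafSpan w ∧
        T.phi (l v) = Ideal.Quotient.mk T.sumIdeal (bottomMonomial S w v)) ∧
      T.leafSpan w ≤ Submodule.span ℝ {f | ∃ x : T.Leaf, T.Desc w x.1 ∧ f = l x.1} := by
  induction hn : T.depth - T.depthOf w using Nat.strong_induction_on generalizing w with
  | _ n ih =>
  by_cases hleaf : T.IsLeaf w
  · refine ⟨fun _ => X ⟨w, hleaf⟩, fun v hv => ?_, Submodule.span_mono ?_⟩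
    · obtain rfl := hv.eq_of_isLeaf hleaf
      refine ⟨Submodule.subset_span ⟨_, Desc.refl T _, rfl⟩, ?_⟩
      exact (phi_X ⟨v, hleaf⟩).trans (congrArg _ (bottomMonomial_eq_hpm v).symm)
    · rintro f ⟨x, hx, rfl⟩
      exact ⟨x, hx, congrArg X (Subtype.ext (hx.eq_of_isLeaf hleaf))⟩
  -- the forms of the children
  have hchild : ∀ c, T.IsChild w c → ∃ l : T.V → MvPolynomial T.Leaf ℝ,
      (∀ v, T.Desc c v → l v ∈ T.leafSpan c ∧
        T.phi (l v) = Ideal.Quotient.mk T.sumIdeal (bottomMonomial S c v)) ∧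
      T.leafSpan c ≤ Submodule.span ℝ {f | ∃ x : T.Leaf, T.Desc c x.1 ∧ f = l x.1} := by
    intro c hc
    refine ih (T.depth - T.depthOf c) ?_ c (hw.of_desc hc.desc) rfl
    have := T.depthOf_le_depth c
    have := hc.depthOf
    omega
  choose! l hl hspan using hchild
  have hne : (Finset.univ.filter fun c => T.IsChild w c).Nonempty := by
    obtain ⟨c, hc⟩ := not_forall.1 hleaf
    exact ⟨c, by simpa using hc⟩
  obtain ⟨c₁, hc₁, hmin⟩ := Finset.exists_min_image _ T.label hne
  simp only [Finset.mem_filter, Finset.mem_univ, true_and] at hc₁ hmin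
  have hnotS : ∀ c, T.IsChild w c → c ∉ S := fun c hc => hw.child_notMem hpar hc
  have hmod₁ : modLabel S c₁ = none := by
    refine if_pos ⟨hnotS c₁ hc₁, ?_⟩
    rw [hc₁.2]
    exact hmin
  have hmod : ∀ c, T.IsChild w c → c ≠ c₁ → modLabel S c = some (T.label c) := by
    refine fun c hc hcne => if_neg fun h => hcne ?_
    refine hc.label_injective hc₁ (le_antisymm ?_ (hmin c hc))
    exact h.2 c₁ (by rw [hc.2]; exact hc₁)
  have hemb : ∀ c, T.IsChild w c → ∃ f, IsSubtreeEmbedding c₁ c f := by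
    intro c hc
    obtain ⟨f, h1, -, h3, h4⟩ := hsip w c₁ c hw hc₁ hc hmin
    exact ⟨f, h1, h3, h4⟩
  choose! f hf using hemb
  -- transport of monomials along the subtree inclusions
  have htrans : ∀ c v, T.IsChild w c → T.Desc c₁ v → bottomMonomial S c (f c v) =
      X (some (T.label c)) *
        (seg (fun u => X (some (T.label u))) T.root w * seg (fun u => X (modLabel S u)) c₁ v *
          X none ^ (T.depth - T.depthOf v)) := by
    intro c v hc hv
    have hd := (hf c hc).depthOf_add hv
    rw [hc.depthOf, hc₁.depthOf] at hd
    rw [bottomMonomial_child hc (f c v),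
      (hf c hc).seg_eq (fun u => X (modLabel S u)) (fun u hu hne => by
        rw [(hf c hc).modLabel_eq hpar (hnotS c₁ hc₁) (hnotS c hc) hu hne]) hv,
      show T.depthOf (f c v) = T.depthOf v by omega]
  have key : ∀ v, T.Desc w v → ∃ q ∈ T.leafSpan w,
      T.phi q = Ideal.Quotient.mk T.sumIdeal (bottomMonomial S w v) ∧
      (T.Desc c₁ v → q - l c₁ v ∈ ⨆ c, ⨆ (_ : T.IsChild w c ∧ c ≠ c₁), T.leafSpan c) ∧
      ∀ c, T.IsChild w c → c ≠ c₁ → T.Desc c v → q = l c v := by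
    intro v hv
    by_cases hvw : v = w
    · subst hvw
      refine ⟨∑ c ∈ Finset.univ.filter (fun c => T.IsChild v c), l c c,
        Submodule.sum_mem _ fun c hc => ?_, ?_, fun h => absurd h hc₁.not_desc,
        fun c hc _ h => absurd h hc.not_desc⟩
      · have hc : T.IsChild v c := by simpa using hc
        exact leafSpan_mono hc.desc (hl c hc c (Desc.refl T c)).1
      · obtain ⟨d, hd⟩ := hne
        have hd : T.IsChild v d := by simpa using hd
        rw [bottomMonomial_self hd, map_mul, ← mk_sum_label hleaf, Finset.sum_mul, map_sum]
        refine Finset.sum_congr rfl fun c hc => ?_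
        have hc : T.IsChild v c := by simpa using hc
        rw [(hl c hc c (Desc.refl T c)).2, bottomMonomial_child hc c, map_mul,
          seg_self, seg_self, hc.depthOf, hd.depthOf]
    · obtain ⟨c, hc, hcv⟩ := hv.exists_child hvw
      by_cases hcc : c = c₁
      · subst hcc
        refine ⟨l c v + ∑ c' ∈ (Finset.univ.filter fun c' => T.IsChild w c').erase c,
          l c' (f c' v), ?_, ?_, fun _ => ?_, fun c' hc' hne' h =>
            absurd (hc'.eq_of_desc hc h hcv) hne'⟩
        · refine Submodule.add_mem _ (leafSpan_mono hc.desc (hl c hc v hcv).1)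
            (Submodule.sum_mem _ fun c' hc' => ?_)
          have hc' : T.IsChild w c' := by simpa using (Finset.mem_erase.1 hc').2
          exact leafSpan_mono hc'.desc (hl c' hc' _ ((hf c' hc').desc hcv)).1
        · rw [bottomMonomial_eq_modLabel_mul hc hcv, hmod₁, map_mul, ← mk_sum_label hleaf,
            Finset.sum_mul, map_add, map_sum,
            ← Finset.add_sum_erase _ _ (Finset.mem_filter.2 ⟨Finset.mem_univ c, hc⟩),
            (hl c hc v hcv).2, bottomMonomial_child hc v, map_mul]
          congr 1
          refine Finset.sum_congr rfl fun c' hc' => ?_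
          have hc' : T.IsChild w c' := by simpa using (Finset.mem_erase.1 hc').2
          rw [(hl c' hc' _ ((hf c' hc').desc hcv)).2, htrans c' v hc' hcv, map_mul]
        · rw [add_sub_cancel_left]
          refine Submodule.sum_mem _ fun c' hc' => ?_
          obtain ⟨hne', hc'⟩ := Finset.mem_erase.1 hc'
          have hc' : T.IsChild w c' := by simpa using hc'
          exact Submodule.mem_iSup_of_mem c' (Submodule.mem_iSup_of_mem ⟨hc', hne'⟩
            (hl c' hc' _ ((hf c' hc').desc hcv)).1)
      · refine ⟨l c v, leafSpan_mono hc.desc (hl c hc v hcv).1, ?_,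
          fun h => absurd (hc.eq_of_desc hc₁ hcv h) hcc, fun c' hc' _ h => ?_⟩
        · rw [(hl c hc v hcv).2, bottomMonomial_eq_modLabel_mul hc hcv, hmod c hc hcc,
            bottomMonomial_child hc v]
        · rw [hc.eq_of_desc hc' hcv h]
  choose! q hq hphi hq₁ hqc using key
  refine ⟨q, fun v hv => ⟨hq v hv, hphi v hv⟩, ?_⟩
  set U := Submodule.span ℝ {f | ∃ x : T.Leaf, T.Desc w x.1 ∧ f = q x.1} with hU
  have hUc : ∀ c, T.IsChild w c → c ≠ c₁ → T.leafSpan c ≤ U := by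
    refine fun c hc hcne => (hspan c hc).trans (Submodule.span_mono ?_)
    rintro g ⟨x, hx, rfl⟩
    exact ⟨x, hc.desc.trans hx, (hqc x.1 (hc.desc.trans hx) c hc hcne hx).symm⟩
  refine leafSpan_le_of_children hleaf fun c hc => ?_
  by_cases hcc : c = c₁
  · subst hcc
    refine (hspan c hc).trans (Submodule.span_le.2 ?_)
    rintro g ⟨x, hx, rfl⟩
    have hwx := hc.desc.trans hx
    have h1 : q x.1 ∈ U := Submodule.subset_span ⟨x, hwx, rfl⟩
    have h2 : q x.1 - l c x.1 ∈ U :=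
      (iSup_le fun c' => iSup_le fun hc' => hUc c' hc'.1 hc'.2) (hq₁ x.1 hwx hx)
    simpa using U.sub_mem h1 h2
  · exact hUc c hc hcc

end Order

end Bottom

section Top

theorem sameStage_of_label_eq {u v c d : T.V} (hc : T.IsChild u c) (hd : T.IsChild v d)
    (h : T.label c = T.label d) : T.SameStage u v := by
  refine ⟨fun hl => hl c hc, fun hl => hl d hd, fun θ => ?_⟩
  have := (T.stage_disjoint u v).resolve_right fun H =>
    H (T.label c) ⟨⟨c, hc.1, hc.2, rfl⟩, d, hd.1, hd.2, h.symm⟩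
  simpa only [IsChild, and_assoc] using this θ

/-- Children of vertices in the same stage are matched by their labels. -/
theorem SameStage.sum_children_eq {M : Type*} [AddCommMonoid M] {u v : T.V}
    (h : T.SameStage u v) (F G : T.V → M)
    (hFG : ∀ c d, T.IsChild u c → T.IsChild v d → T.label c = T.label d → F c = G d) :
    ∑ c ∈ Finset.univ.filter (fun c => T.IsChild u c), F c =
      ∑ d ∈ Finset.univ.filter (fun d => T.IsChild v d), G d := by
  have hex : ∀ c, T.IsChild u c → ∃ d, T.IsChild v d ∧ T.label d = T.label c :=
    fun c hc => (h.2.2 _).1 ⟨c, hc, rfl⟩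
  choose! i hi hil using hex
  refine Finset.sum_bij (fun c _ => i c) ?_ ?_ ?_ ?_
  · intro c hc
    simp only [Finset.mem_filter, Finset.mem_univ, true_and] at hc ⊢
    exact hi c hc
  · intro c hc c' hc' he
    simp only [Finset.mem_filter, Finset.mem_univ, true_and] at hc hc'
    exact hc.label_injective hc' (by rw [← hil c hc, ← hil c' hc', he])
  · intro d hd
    simp only [Finset.mem_filter, Finset.mem_univ, true_and] at hd
    obtain ⟨c, hc, hcd⟩ := (h.2.2 _).2 ⟨d, hd, rfl⟩
    exact ⟨c, by simpa using hc, (hi c hc).label_injective hd ((hil c hc).trans hcd)⟩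
  · intro c hc
    simp only [Finset.mem_filter, Finset.mem_univ, true_and] at hc
    exact hFG c (i c) hc (hi c hc) (hil c hc).symm

variable {S : Set T.V}

theorem SInternal.not_sLeaf {u : T.V} (h : T.SInternal S u) : ¬ T.SLeaf S u := by
  obtain ⟨-, c, hc, hcS⟩ := h
  exact fun hl => hl.2 c hc hcS

theorem SInternal.child_mem
    (hsib : ∀ v c c', T.IsChild v c → T.IsChild v c' → c ∈ S → c' ∈ S) {u c : T.V}
    (h : T.SInternal S u) (hc : T.IsChild u c) : c ∈ S := by
  obtain ⟨-, d, hd, hdS⟩ := h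
  exact hsib u d c hd hc hdS

theorem sInternal_parent (hpar : ∀ w ∈ S, T.parent w ∈ S) {c : T.V} (hc : c ∈ S)
    (hr : c ≠ T.root) : T.SInternal S (T.parent c) :=
  ⟨hpar c hc, c, ⟨hr, rfl⟩, hc⟩

theorem tpolyIn_of_sLeaf (hpar : ∀ w ∈ S, T.parent w ∈ S) {v : T.V} (hv : T.SLeaf S v) :
    T.tpolyIn S v = 1 := by
  have : Finset.univ.filter (fun w => T.SLeaf S w ∧ T.Desc v w) = {v} := by
    ext w
    simp only [Finset.mem_filter, Finset.mem_univ, true_and, Finset.mem_singleton]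
    exact ⟨fun h => hv.eq_of_desc hpar h.2 h.1.1, by rintro rfl; exact ⟨hv, Desc.refl T w⟩⟩
  rw [tpolyIn, this]
  simp

theorem tpolyIn_of_sInternal {u : T.V} (hu : T.SInternal S u) :
    T.tpolyIn S u = ∑ c ∈ Finset.univ.filter (fun c => T.IsChild u c),
      X (T.label c) * T.tpolyIn S c := by
  rw [tpolyIn, sum_desc_eq_sum_children _ _ hu.not_sLeaf]
  refine Finset.sum_congr rfl fun c hc => ?_
  simp only [Finset.mem_filter, Finset.mem_univ, true_and] at hc
  rw [tpolyIn, Finset.mul_sum]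
  refine Finset.sum_congr rfl fun l hl => ?_
  simp only [Finset.mem_filter, Finset.mem_univ, true_and] at hl
  exact seg_child (fun u => (X (T.label u) : MvPolynomial Θ ℝ)) hc hl.2

theorem eval_tpolyIn_pos (hpar : ∀ w ∈ S, T.parent w ∈ S)
    (hsib : ∀ v c c', T.IsChild v c → T.IsChild v c' → c ∈ S → c' ∈ S) {h : Θ → ℝ}
    (hh : ∀ θ, 0 < h θ) (u : T.V) (hu : u ∈ S) : 0 < eval h (T.tpolyIn S u) := by
  induction hn : T.depth - T.depthOf u using Nat.strong_induction_on generalizing u with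
  | _ n ih =>
  by_cases hl : T.SLeaf S u
  · rw [tpolyIn_of_sLeaf hpar hl, map_one]
    exact one_pos
  · have hi : T.SInternal S u := by
      refine ⟨hu, ?_⟩
      by_contra hne
      exact hl ⟨hu, fun c hc hcS => hne ⟨c, hc, hcS⟩⟩
    rw [tpolyIn_of_sInternal hi, map_sum]
    refine Finset.sum_pos (fun c hc => ?_) ?_
    · simp only [Finset.mem_filter, Finset.mem_univ, true_and] at hc
      rw [map_mul, eval_X]
      refine mul_pos (hh _) (ih _ ?_ c (hi.child_mem hsib hc) rfl)
      have := T.depthOf_le_depth c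
      have := hc.depthOf
      omega
    · obtain ⟨c, hc, -⟩ := hi.2
      exact ⟨c, by simpa using hc⟩

theorem BalancedIn.cross_mul (hpar : ∀ w ∈ S, T.parent w ∈ S) (hb : T.BalancedIn S) {c d : T.V}
    (hc : c ∈ S) (hd : d ∈ S) (hc0 : c ≠ T.root) (hd0 : d ≠ T.root)
    (h : T.label c = T.label d) :
    T.tpolyIn S c * T.tpolyIn S (T.parent d) = T.tpolyIn S d * T.tpolyIn S (T.parent c) := by
  have hic := sInternal_parent hpar hc hc0
  have hid := sInternal_parent hpar hd hd0
  have hst := sameStage_of_label_eq (u := T.parent c) (v := T.parent d) ⟨hc0, rfl⟩ ⟨hd0, rfl⟩ h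
  rw [tpolyIn_of_sInternal hic, tpolyIn_of_sInternal hid, Finset.mul_sum, Finset.mul_sum]
  refine (hst.sum_children_eq _ _ fun c' d' hc' hd' he => ?_).symm
  have := hb _ _ c c' d d' hic hid hst ⟨hc0, rfl⟩ hc' ⟨hd0, rfl⟩ hd' h he
  rw [he]
  linear_combination (-X (T.label d')) * this

variable [LinearOrder Θ]

theorem modLabel_eq_none_iff {v : T.V} : modLabel S v = none ↔
    v ∉ S ∧ ∀ c, T.IsChild (T.parent v) c → T.label v ≤ T.label c := by
  unfold modLabel
  split_ifs with h
  · exact iff_of_true rfl h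
  · exact iff_of_false not_false h

theorem modLabel_eq_none_congr {c d : T.V} (hd : d ∉ S) (hc0 : c ≠ T.root)
    (hd0 : d ≠ T.root) (h : T.label c = T.label d) (hn : modLabel S c = none) :
    modLabel S d = none := by
  rw [modLabel_eq_none_iff] at hn ⊢
  have hst := sameStage_of_label_eq (u := T.parent c) (v := T.parent d) ⟨hc0, rfl⟩ ⟨hd0, rfl⟩ h
  refine ⟨hd, fun d' hd' => ?_⟩
  obtain ⟨c', hc', he⟩ := (hst.2.2 _).2 ⟨d', hd', rfl⟩
  rw [← h, ← he]
  exact hn.2 c' hc'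

/-- A reparametrisation of the labels: a rescaling by `r` which is twisted by the quotients
`t c / t (parent c)` in the top part, and in which the first label of each bottom stage is
determined by the other ones. -/
theorem exists_reparametrisation (hroot : T.root ∈ S) (hpar : ∀ w ∈ S, T.parent w ∈ S)
    (hsib : ∀ v c c', T.IsChild v c → T.IsChild v c' → c ∈ S → c' ∈ S)
    (hdisj : ∀ u w, T.SInternal S u → T.InBottom S w → ¬ T.SameStage u w)
    (t : T.V → ℝ) (ht : ∀ u ∈ S, 0 < t u)
    (hcross : ∀ c d, c ∈ S → d ∈ S → c ≠ T.root → d ≠ T.root → T.label c = T.label d →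
      t c * t (T.parent d) = t d * t (T.parent c)) (g : Option Θ → ℝ) (r : ℝ) :
    ∃ g' : Option Θ → ℝ, g' none = r * g none ∧
      (∀ c ∈ S, c ≠ T.root →
        g' (some (T.label c)) = r * g (some (T.label c)) * (t c / t (T.parent c))) ∧
      ∀ c ∉ S, g' (some (T.label c)) = r * g (some (T.label c)) +
        if modLabel S c = none then r * (g none -
          ∑ d ∈ Finset.univ.filter (fun d => T.IsChild (T.parent c) d), g (some (T.label d)))
        else 0 := by
  have hne : ∀ c ∉ S, c ≠ T.root := fun c hc h => hc (h ▸ hroot)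
  refine ⟨fun o => o.elim (r * g none) fun θ =>
    if H : ∃ c, c ∈ S ∧ c ≠ T.root ∧ T.label c = θ then
      r * g (some θ) * (t H.choose / t (T.parent H.choose))
    else if H : ∃ c, c ∉ S ∧ modLabel S c = none ∧ T.label c = θ then
      r * g (some θ) + r * (g none -
        ∑ d ∈ Finset.univ.filter (fun d => T.IsChild (T.parent H.choose) d),
          g (some (T.label d)))
    else r * g (some θ), rfl, fun c hc hc0 => ?_, fun c hc => ?_⟩
  · have H : ∃ d, d ∈ S ∧ d ≠ T.root ∧ T.label d = T.label c := ⟨c, hc, hc0, rfl⟩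
    obtain ⟨h1, h2, h3⟩ := H.choose_spec
    simp only [Option.elim_some, dif_pos H]
    congr 1
    rw [div_eq_div_iff (ht _ (hpar _ h1)).ne' (ht _ (hpar _ hc)).ne']
    exact hcross _ _ h1 hc h2 hc0 h3
  · have H : ¬ ∃ d, d ∈ S ∧ d ≠ T.root ∧ T.label d = T.label c := by
      rintro ⟨d, hd, hd0, hdc⟩
      exact hdisj _ _ (sInternal_parent hpar hd hd0) (inBottom_of_notMem hroot hsib hc)
        (sameStage_of_label_eq ⟨hd0, rfl⟩ ⟨hne c hc, rfl⟩ hdc)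
    simp only [Option.elim_some, dif_neg H]
    by_cases hn : modLabel S c = none
    · have H' : ∃ d, d ∉ S ∧ modLabel S d = none ∧ T.label d = T.label c := ⟨c, hc, hn, rfl⟩
      obtain ⟨h1, h2, h3⟩ := H'.choose_spec
      rw [dif_pos H', if_pos hn, (sameStage_of_label_eq ⟨hne _ h1, rfl⟩ ⟨hne c hc, rfl⟩
        h3).sum_children_eq (fun d => g (some (T.label d))) (fun d => g (some (T.label d)))
        fun _ _ _ _ he => by rw [he]]
    · have H' : ¬ ∃ d, d ∉ S ∧ modLabel S d = none ∧ T.label d = T.label c := by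
        rintro ⟨d, hd, hdn, hdc⟩
        exact hn (modLabel_eq_none_congr hc (hne d hd) (hne c hc) hdc hdn)
      rw [dif_neg H', if_neg hn, add_zero]

variable (S) in
/-- The monomial attached to a leaf `x` after replacing the first edges below `S` by the
homogenising variable. -/
def leafMonomial (x : T.V) : MvPolynomial (Option Θ) ℝ :=
  seg (fun u => X (modLabel S u)) T.root x * X none ^ (T.depth - T.depthOf x)

theorem eval_leafMonomial (g : Option Θ → ℝ) (x : T.V) : eval g (leafMonomial S x) =
    seg (fun u => g (modLabel S u)) T.root x * g none ^ (T.depth - T.depthOf x) := by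
  simp [leafMonomial, seg, map_prod]

theorem SLeaf.bottomMonomial_eq (hpar : ∀ w ∈ S, T.parent w ∈ S) {v x : T.V}
    (hv : T.SLeaf S v) (h : T.Desc v x) : bottomMonomial S v x = leafMonomial S x := by
  rw [bottomMonomial, leafMonomial, seg_mul_seg _ (T.desc_root v) h]
  congr 2
  refine seg_congr _ (T.desc_root v) fun u _ huv _ => ?_
  rw [modLabel_of_mem (by_contra fun hu => notMem_of_desc hpar hu huv hv.1)]

/-- Every positive point has the same leaf monomials as some point satisfying the homogenised
sum-to-one conditions. -/
theorem exists_eval_leafMonomial_eq (hroot : T.root ∈ S) (hpar : ∀ w ∈ S, T.parent w ∈ S)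
    (hsib : ∀ v c c', T.IsChild v c → T.IsChild v c' → c ∈ S → c' ∈ S)
    (hb : T.BalancedIn S)
    (hdisj : ∀ u w, T.SInternal S u → T.InBottom S w → ¬ T.SameStage u w)
    (g : Option Θ → ℝ) (hg : ∀ o, 0 < g o) :
    ∃ g' : Option Θ → ℝ, T.sumIdeal ≤ RingHom.ker (eval g') ∧
      ∀ x : T.Leaf, eval g' (leafMonomial S x.1) = eval g (leafMonomial S x.1) := by
  set t : T.V → ℝ := fun u => eval (fun θ => g (some θ) / g none) (T.tpolyIn S u) with ht_def
  have ht : ∀ u ∈ S, 0 < t u := eval_tpolyIn_pos hpar hsib fun θ => div_pos (hg _) (hg _)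
  have htleaf : ∀ u, T.SLeaf S u → t u = 1 := fun u hu => by
    rw [ht_def]
    simp only [tpolyIn_of_sLeaf hpar hu, map_one]
  obtain ⟨r, hr⟩ : ∃ r : ℝ, r ^ T.depth = t T.root := by
    by_cases hd : T.depth = 0
    · refine ⟨1, ?_⟩
      rw [one_pow, htleaf _ ⟨hroot, fun c hc _ => ?_⟩]
      have h1 := hc.depthOf
      have h2 := T.depthOf_le_depth c
      omega
    · exact ⟨t T.root ^ ((T.depth : ℝ)⁻¹), Real.rpow_inv_natCast_pow (ht _ hroot).le hd⟩
  obtain ⟨g', hg0, hgS, hgB⟩ := exists_reparametrisation hroot hpar hsib hdisj t ht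
    (fun c d hc hd hc0 hd0 h => by
      simpa only [map_mul] using congrArg (eval fun θ => g (some θ) / g none)
        (hb.cross_mul hpar hc hd hc0 hd0 h)) g r
  refine ⟨g', Ideal.span_le.2 ?_, fun x => ?_⟩
  · rintro f ⟨v, hv, rfl⟩
    simp only [SetLike.mem_coe, RingHom.mem_ker, map_sub, map_sum, eval_X, hg0, sub_eq_zero]
    rcases sInternal_or_inBottom hroot hsib v with hi | hw
    · have h1 : t v = ∑ c ∈ Finset.univ.filter (fun c => T.IsChild v c),
          g (some (T.label c)) / g none * t c := by
        simp only [ht_def]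
        rw [tpolyIn_of_sInternal hi]
        simp
      have h2 : ∀ c ∈ Finset.univ.filter (fun c => T.IsChild v c), g' (some (T.label c)) =
          r * g none / t v * (g (some (T.label c)) / g none * t c) := by
        intro c hc
        have hc : T.IsChild v c := by simpa using hc
        rw [hgS c (hi.child_mem hsib hc) hc.1, hc.2]
        have := (hg none).ne'
        field_simp
      rw [Finset.sum_congr rfl h2, ← Finset.mul_sum, ← h1, div_mul_cancel₀ _ (ht v hi.1).ne']
    · have hne : (Finset.univ.filter fun c => T.IsChild v c).Nonempty := by
        obtain ⟨c, hc⟩ := not_forall.1 hv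
        exact ⟨c, by simpa using hc⟩
      obtain ⟨c₁, hc₁, hmin⟩ := Finset.exists_min_image _ T.label hne
      have hc₁' : T.IsChild v c₁ := by simpa using hc₁
      have h2 : ∀ c ∈ Finset.univ.filter (fun c => T.IsChild v c), g' (some (T.label c)) =
          r * g (some (T.label c)) + if c₁ = c then r * (g none -
            ∑ d ∈ Finset.univ.filter (fun d => T.IsChild v d), g (some (T.label d))) else 0 := by
        intro c hc
        have hc' : T.IsChild v c := by simpa using hc
        rw [hgB c (hw.child_notMem hpar hc'), hc'.2]
        congr 1
        refine if_congr ?_ rfl rfl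
        rw [modLabel_eq_none_iff, hc'.2]
        constructor
        · exact fun h => hc₁'.label_injective hc' (le_antisymm (hmin c hc) (h.2 c₁ hc₁'))
        · rintro rfl
          exact ⟨hw.child_notMem hpar hc', fun d hd => hmin d (by simpa using hd)⟩
      rw [Finset.sum_congr rfl h2, Finset.sum_add_distrib, Finset.sum_ite_eq, if_pos hc₁,
        ← Finset.mul_sum]
      ring
  · have hpath : ∀ u, seg (fun u => g' (modLabel S u)) T.root u * t T.root =
        r ^ T.depthOf u * seg (fun u => g (modLabel S u)) T.root u *
          if u ∈ S then t u else 1 := by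
      intro u
      refine (T.desc_root u).induction ?_ fun u hu _ hd ih => ?_
      · simp [seg_self, depthOf_root, hroot]
      · rw [seg_step _ hu hd, seg_step _ hu hd, T.depthOf_parent hu, pow_succ, mul_assoc, ih]
        by_cases huS : u ∈ S
        · have := (ht _ (hpar u huS)).ne'
          rw [if_pos huS, if_pos (hpar u huS), modLabel_of_mem huS, hgS u huS hu]
          field_simp
        · have h1 : g' (modLabel S u) = r * g (modLabel S u) := by
            by_cases hn : modLabel S u = none
            · rw [hn, hg0]
            · have h2 : modLabel S u = some (T.label u) :=
                if_neg fun h => hn (modLabel_eq_none_iff.2 h)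
              rw [h2, hgB u huS, if_neg hn, add_zero]
          have h3 : (if T.parent u ∈ S then t (T.parent u) else 1) = 1 := by
            split_ifs with hp
            · exact htleaf _ ((inBottom_of_notMem hroot hsib huS).sLeaf hpar hp)
            · rfl
          rw [if_neg huS, h3, h1]
          ring
    have hx := hpath x.1
    have h1 : (if x.1 ∈ S then t x.1 else 1) = 1 := by
      split_ifs with hp
      · exact htleaf _ ((exists_sLeaf hroot hsib x).sLeaf hpar hp)
      · rfl
    rw [h1, mul_one] at hx
    refine mul_right_cancel₀ (ht _ hroot).ne' ?_
    rw [eval_leafMonomial, eval_leafMonomial, hg0, mul_pow, mul_right_comm, hx, ← hr,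
      ← Nat.sub_add_cancel (T.depthOf_le_depth x.1), pow_add]
    simp only [Nat.add_sub_cancel]
    ring

/-- The homogenised sum-to-one conditions impose no relation on the leaf monomials. -/
theorem aeval_leafMonomial_eq_zero (hroot : T.root ∈ S) (hpar : ∀ w ∈ S, T.parent w ∈ S)
    (hsib : ∀ v c c', T.IsChild v c → T.IsChild v c' → c ∈ S → c' ∈ S)
    (hb : T.BalancedIn S)
    (hdisj : ∀ u w, T.SInternal S u → T.InBottom S w → ¬ T.SameStage u w)
    {F : MvPolynomial T.Leaf ℝ}
    (hF : aeval (fun x : T.Leaf => leafMonomial S x.1) F ∈ T.sumIdeal) :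
    aeval (fun x : T.Leaf => leafMonomial S x.1) F = 0 := by
  refine funext_set (fun _ => Set.Ioi (0 : ℝ)) (fun _ => Set.Ioi_infinite 0) fun g hg => ?_
  obtain ⟨g', hg', hx⟩ := exists_eval_leafMonomial_eq hroot hpar hsib hb hdisj g
    fun o => hg o (Set.mem_univ o)
  have h : ∀ k : Option Θ → ℝ, eval k (aeval (fun x : T.Leaf => leafMonomial S x.1) F) =
      eval (fun x : T.Leaf => eval k (leafMonomial S x.1)) F := by
    intro k
    rw [aeval_def, eval₂_comp_left]
    congr 1
    exact RingHom.ext fun a => by simp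
  have h0 := RingHom.mem_ker.1 (hg' hF)
  rw [map_zero, h, ← funext hx, ← h, h0]

end Top

/-- The kernel of a monomial parametrisation is generated by binomials. -/
theorem ker_aeval_le_span_binomials {R σ τ : Type*} [CommRing R] (p : σ → MvPolynomial τ R)
    (hp : ∀ i, ∃ m, p i = monomial m 1) {F : MvPolynomial σ R} (hF : aeval p F = 0) :
    F ∈ Ideal.span {f | ∃ a b : σ →₀ ℕ, f = monomial a 1 - monomial b 1 ∧ aeval p f = 0} := by
  have hdeg : ∀ a : σ →₀ ℕ, ∃ b, aeval p (monomial a (1 : R)) = monomial b 1 := by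
    intro a
    rw [aeval_monomial, map_one, one_mul]
    refine Finset.prod_induction _ (fun q => ∃ b, q = monomial b (1 : R)) ?_ ⟨0, rfl⟩ ?_
    · rintro _ _ ⟨b, rfl⟩ ⟨c, rfl⟩
      exact ⟨b + c, by rw [monomial_mul, one_mul]⟩
    · intro i _
      obtain ⟨m, hm⟩ := hp i
      exact ⟨a i • m, by simp only [hm, monomial_pow, one_pow]⟩
  choose deg hdeg using hdeg
  set I := Ideal.span {f : MvPolynomial σ R | ∃ a b : σ →₀ ℕ, f = monomial a 1 - monomial b 1 ∧ aeval p f = 0}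
  let s : (τ →₀ ℕ) → (σ →₀ ℕ) := Function.invFun deg
  let Φ : MvPolynomial τ R →ₗ[R] MvPolynomial σ R ⧸ I :=
    (basisMonomials τ R).constr R fun b => Ideal.Quotient.mk I (monomial (s b) 1)
  have hΦ : Φ ∘ₗ (aeval p).toLinearMap = (Ideal.Quotient.mkₐ R I).toLinearMap := by
    refine (basisMonomials σ R).ext fun a => ?_
    have h1 : deg (s (deg a)) = deg a := Function.invFun_eq ⟨a, rfl⟩
    have h2 : Φ (monomial (deg a) 1) = Ideal.Quotient.mk I (monomial (s (deg a)) 1) := by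
      have := (basisMonomials τ R).constr_basis R
        (fun b => Ideal.Quotient.mk I (monomial (s b) 1)) (deg a)
      rwa [coe_basisMonomials] at this
    rw [coe_basisMonomials, LinearMap.comp_apply, AlgHom.toLinearMap_apply, hdeg, h2,
      AlgHom.toLinearMap_apply, Ideal.Quotient.mkₐ_eq_mk, Ideal.Quotient.eq]
    exact Ideal.subset_span ⟨_, _, rfl, by rw [map_sub, hdeg, hdeg, h1, sub_self]⟩
  rw [← Ideal.Quotient.eq_zero_iff_mem, ← Ideal.Quotient.mkₐ_eq_mk R, ← AlgHom.toLinearMap_apply,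
    ← hΦ, LinearMap.comp_apply, AlgHom.toLinearMap_apply, hF, map_zero]

theorem exists_leafMonomial_eq_monomial [LinearOrder Θ] (S : Set T.V) (x : T.V) :
    ∃ m, leafMonomial S x = monomial m 1 := by
  have hmul : ∀ q q' : MvPolynomial (Option Θ) ℝ, (∃ m, q = monomial m 1) →
      (∃ m, q' = monomial m 1) → ∃ m, q * q' = monomial m 1 := by
    rintro _ _ ⟨b, rfl⟩ ⟨c, rfl⟩
    exact ⟨b + c, by rw [monomial_mul, one_mul]⟩
  refine hmul _ _ ?_ ⟨_, X_pow_eq_monomial⟩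
  exact Finset.prod_induction _ (fun q => ∃ m, q = monomial m (1 : ℝ)) hmul ⟨0, rfl⟩
    fun i _ => ⟨_, rfl⟩

theorem leafSpan_root :
    T.leafSpan T.root = Submodule.span ℝ (Set.range (X : T.Leaf → MvPolynomial T.Leaf ℝ)) := by
  rw [leafSpan]
  congr 1
  ext f
  exact ⟨fun ⟨x, _, hf⟩ => ⟨x, hf.symm⟩, fun ⟨x, hf⟩ => ⟨x, T.desc_root _, hf.symm⟩⟩

/-- In suitable linear coordinates the parametrisation is given by the leaf monomials. -/
theorem exists_linear_forms [LinearOrder Θ] {S : Set T.V} (hroot : T.root ∈ S)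
    (hpar : ∀ w ∈ S, T.parent w ∈ S)
    (hsib : ∀ v c c', T.IsChild v c → T.IsChild v c' → c ∈ S → c' ∈ S)
    (hsip : ∀ w c1 c, T.InBottom S w → T.IsChild w c1 → T.IsChild w c →
      (∀ c', T.IsChild w c' → T.label c1 ≤ T.label c') → T.SIPat c1 c) :
    ∃ L : T.Leaf → MvPolynomial T.Leaf ℝ,
      Submodule.span ℝ (Set.range L) = Submodule.span ℝ (Set.range X) ∧
      ∀ x, T.phi (L x) = Ideal.Quotient.mk T.sumIdeal (leafMonomial S x.1) := by
  have h := exists_bottom_forms hpar hsip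
  choose! l hl hspan using h
  choose v hv hvx using exists_sLeaf (S := S) hroot hsib
  have hbot : ∀ x, T.InBottom S (v x) := fun x => ⟨v x, hv x, Desc.refl T _⟩
  refine ⟨fun x => l (v x) x.1, le_antisymm ?_ ?_, fun x => ?_⟩
  · rw [Submodule.span_le, ← leafSpan_root]
    rintro _ ⟨x, rfl⟩
    exact leafSpan_mono (T.desc_root (v x)) (hl _ (hbot x) x.1 (hvx x)).1
  · rw [Submodule.span_le]
    rintro _ ⟨y, rfl⟩
    refine ((hspan _ (hbot y)).trans (Submodule.span_mono ?_))
      (Submodule.subset_span ⟨y, hvx y, rfl⟩)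
    rintro _ ⟨x, hx, rfl⟩
    exact ⟨x, congrArg (l · x.1) ((hv x).unique hpar (hv y) (hvx x) hx)⟩
  · rw [(hl _ (hbot x) x.1 (hvx x)).2, (hv x).bottomMonomial_eq hpar (hvx x)]

variable (T)

/-- Let `𝒮` be a subtree of `𝒯` with the same root (given by a
parent-closed, sibling-closed vertex set `S` containing the root) and let `v₁,…,v_m` be
the leaves of `𝒮`. If (1) `𝒮` is balanced, (2) no internal vertex of `𝒮` is in the same
stage as a vertex of `𝒯(v₁),…,𝒯(v_m)`, and (3) the stages of vertices in
`𝒯(v₁),…,𝒯(v_m)` satisfy the subtree-inclusion property, then `𝒯` has toric structure. -/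
theorem toric_of_balanced_top_sip_bottom [LinearOrder Θ] (S : Set T.V)
    (hroot : T.root ∈ S) (hpar : ∀ w ∈ S, T.parent w ∈ S)
    (hsib : ∀ v c c', T.IsChild v c → T.IsChild v c' → c ∈ S → c' ∈ S)
    (h1 : T.BalancedIn S)
    (h2 : ∀ u w, T.SInternal S u → T.InBottom S w → ¬ T.SameStage u w)
    (h3 : ∀ w c1 c, T.InBottom S w → T.IsChild w c1 → T.IsChild w c →
      (∀ c', T.IsChild w c' → T.label c1 ≤ T.label c') → T.SIPat c1 c) :
    T.Toric := by
  obtain ⟨L, hspan, hphi⟩ := exists_linear_forms hroot hpar hsib h3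
  have hLmem : ∀ x, L x ∈ Submodule.span ℝ (Set.range (X : T.Leaf → MvPolynomial T.Leaf ℝ)) :=
    fun x => hspan ▸ Submodule.subset_span ⟨x, rfl⟩
  have hhom : Submodule.span ℝ (Set.range (X : T.Leaf → MvPolynomial T.Leaf ℝ)) ≤
      homogeneousSubmodule T.Leaf ℝ 1 := by
    rw [Submodule.span_le]
    rintro _ ⟨x, rfl⟩
    exact isHomogeneous_X ℝ x
  have hcomp : ∀ F : MvPolynomial T.Leaf ℝ, T.phi (aeval L F) = Ideal.Quotient.mk T.sumIdeal
      (aeval (fun x : T.Leaf => leafMonomial S x.1) F) := by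
    refine fun F => DFunLike.congr_fun (f := T.phi.comp (aeval L))
      (g := (Ideal.Quotient.mkₐ ℝ T.sumIdeal).comp
        (aeval fun x : T.Leaf => leafMonomial S x.1)) (algHom_ext fun x => ?_) F
    simp only [AlgHom.comp_apply, aeval_X, hphi, Ideal.Quotient.mkₐ_eq_mk]
  have hsurj : ∀ f, ∃ F : MvPolynomial T.Leaf ℝ, aeval L F = f := by
    have hX : ∀ x, ∃ F : MvPolynomial T.Leaf ℝ, aeval L F = X x := by
      intro x
      have hle : Submodule.span ℝ (Set.range L) ≤ (aeval (R := ℝ) L).range.toSubmodule := by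
        rw [Submodule.span_le]
        rintro _ ⟨y, rfl⟩
        exact ⟨X y, aeval_X L y⟩
      exact hle (hspan ▸ Submodule.subset_span ⟨x, rfl⟩)
    choose G hG using hX
    refine fun f => ⟨aeval G f, ?_⟩
    refine DFunLike.congr_fun (f := (aeval (R := ℝ) L).comp (aeval G)) (g := AlgHom.id ℝ _)
      (algHom_ext fun x => ?_) f
    simp only [AlgHom.comp_apply, aeval_X, hG, AlgHom.id_apply]
  have hmon : ∀ a : T.Leaf →₀ ℕ, aeval L (monomial a (1 : ℝ)) = ∏ i, L i ^ a i := by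
    intro a
    rw [aeval_monomial, map_one, one_mul, Finsupp.prod_fintype _ _ fun i => pow_zero _]
  refine ⟨L, fun i => hhom (hLmem i), ?_, {f | (∃ a b : T.Leaf → ℕ,
    f = (∏ i, L i ^ a i) - ∏ i, L i ^ b i) ∧ T.phi f = 0}, fun f hf => hf.1,
    le_antisymm (fun f hf => ?_) (Ideal.span_le.2 fun f hf => hf.2)⟩
  · rw [linearIndependent_iff_card_eq_finrank_span, Set.finrank, hspan]
    exact linearIndependent_iff_card_eq_finrank_span.1 (linearIndependent_X T.Leaf ℝ)
  · obtain ⟨F, rfl⟩ := hsurj f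
    have h0 : T.phi (aeval L F) = 0 := hf
    rw [hcomp, Ideal.Quotient.eq_zero_iff_mem] at h0
    have hF := ker_aeval_le_span_binomials _
      (fun x : T.Leaf => exists_leafMonomial_eq_monomial S x.1)
      (aeval_leafMonomial_eq_zero hroot hpar hsib h1 h2 h0)
    refine (Ideal.span_le (I := Ideal.comap (aeval L) (Ideal.span _))).2 ?_ hF
    rintro _ ⟨a, b, rfl, hab⟩
    refine Ideal.subset_span ⟨⟨a, b, ?_⟩, ?_⟩
    · rw [map_sub, hmon, hmon]
    · rw [hcomp, hab, map_zero]

end StagedTree
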